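/- Quantitative exit from a neighborhood of the Hill boundary: fix h > 0. There exist constants ε₀ > 0, K > 1 and C > 0 with the following property: for every ε ∈ (0, ε₀) and every solution q(t) of Newton's N-body equations with total energy E = −h whose maximal interval of definition contains t₀ and which satisfies U(q(t₀)) ≤ h + ε, there is a time t₁ with t₀ < t₁ ≤ t₀ + C·√ε, lying in the maximal interval of definition, such that U(q(t₁)) ≥ h + K·ε. -/

import Mathlib

open Finset Filter MeasureTheory
open scoped RealInnerProductSpace

noncomputable section

/-- Configuration space of `N` bodies in `ℝ³`. -/
abbrev Config (N : ℕ) := Fin N → EuclideanSpace ℝ (Fin 3)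

/-- A configuration is collision-free if all bodies occupy distinct positions. -/
def CollisionFree {N : ℕ} (q : Config N) : Prop :=
  ∀ a b : Fin N, a ≠ b → q a ≠ q b

/-- The Newtonian potential `U(q) = G ∑_{a<b} m_a m_b / |q_a - q_b|`. -/
def potU {N : ℕ} (G : ℝ) (m : Fin N → ℝ) (q : Config N) : ℝ :=
  G * ∑ a : Fin N, ∑ b : Fin N, if a < b then m a * m b / ‖q a - q b‖ else 0

/-- Kinetic energy `K = (1/2) ∑_a m_a |v_a|²`. -/
def kinE {N : ℕ} (m : Fin N → ℝ) (v : Config N) : ℝ :=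
  (1 / 2) * ∑ a : Fin N, m a * ‖v a‖ ^ 2

/-- Moment of inertia `I = ∑_a m_a |q_a|²`. -/
def momI {N : ℕ} (m : Fin N → ℝ) (q : Config N) : ℝ :=
  ∑ a : Fin N, m a * ‖q a‖ ^ 2

/-- `q, v : ℝ → Config N` is a solution of Newton's N-body equations on `J`:
at each time in `J` the configuration is collision-free, `v` is the derivative
of `q`, and the acceleration satisfies
`m_a q̈_a = G ∑_{b ≠ a} m_a m_b (q_b - q_a)/|q_b - q_a|³`. -/
def IsSolutionOn {N : ℕ} (G : ℝ) (m : Fin N → ℝ) (J : Set ℝ)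
    (q v : ℝ → Config N) : Prop :=
  ∀ t ∈ J,
    CollisionFree (q t) ∧
    (∀ a, HasDerivAt (fun s => q s a) (v t a) t) ∧
    (∀ a, ∃ acc : EuclideanSpace ℝ (Fin 3),
      HasDerivAt (fun s => v s a) acc t ∧
      m a • acc = ∑ b ∈ univ.filter (fun b => b ≠ a),
        (G * m a * m b / ‖q t b - q t a‖ ^ 3) • (q t b - q t a))

/-- `(J, q, v)` is a maximal solution: a solution on the open interval `J`
admitting no extension to a strictly larger open interval. -/
def IsMaximalSolution {N : ℕ} (G : ℝ) (m : Fin N → ℝ) (J : Set ℝ)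
    (q v : ℝ → Config N) : Prop :=
  IsOpen J ∧ J.OrdConnected ∧ IsSolutionOn G m J q v ∧
  ∀ (J' : Set ℝ) (q' v' : ℝ → Config N),
    IsOpen J' → J'.OrdConnected → IsSolutionOn G m J' q' v' →
    J ⊆ J' → (∀ t ∈ J, q' t = q t ∧ v' t = v t) → J' = J

open Set Topology in
/-- Extension of a Lipschitz solution of an autonomous ODE past the end of its interval. -/
lemma ode_extend {E : Type*} [NormedAddCommGroup E] [NormedSpace ℝ E] [FiniteDimensional ℝ E]
    (X : E → E) (Ω : Set E) (hΩ : IsOpen Ω) (hX : ∀ x ∈ Ω, ContDiffAt ℝ 1 X x)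
    (z : ℝ → E) (t₀ T : ℝ) (hT : t₀ < T) (L : NNReal)
    (hz : ∀ t ∈ Ico t₀ T, HasDerivAt z (X (z t)) t)
    (hL : LipschitzOnWith L z (Ico t₀ T))
    (hlim : ∀ y, Tendsto z (𝓝[<] T) (𝓝 y) → y ∈ Ω) :
    ∃ δ > (0:ℝ), ∃ w : ℝ → E, (∀ t < T, w t = z t) ∧
      ∀ t ∈ Ico T (T + δ), w t ∈ Ω ∧ HasDerivAt w (X (w t)) t := by
  have : CompleteSpace E := FiniteDimensional.complete ℝ E
  obtain ⟨g, hg, hgz⟩ := hL.extend_finite_dimension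
  set y := g T with hy
  have hmem : Ioo t₀ T ∈ 𝓝[<] T := Ioo_mem_nhdsLT hT
  have hzy : Tendsto z (𝓝[<] T) (𝓝 y) := by
    have h1 : Tendsto g (𝓝[<] T) (𝓝 y) := (hg.continuous.tendsto T).mono_left inf_le_left
    refine h1.congr' ?_
    filter_upwards [hmem] with t ht
    exact (hgz ⟨ht.1.le, ht.2⟩).symm
  have hyΩ : y ∈ Ω := hlim y hzy
  obtain ⟨α, hα0, e, he, hα⟩ :=
    (hX y hyΩ).exists_forall_mem_closedBall_exists_eq_forall_mem_Ioo_hasDerivAt₀ T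
  have hαc : ContinuousAt α T := (hα T ⟨by linarith, by linarith⟩).continuousAt
  have hαΩ : ∀ᶠ t in 𝓝 T, α t ∈ Ω := hαc.eventually (by rw [hα0]; exact hΩ.mem_nhds hyΩ)
  obtain ⟨e', he', hα'⟩ := Metric.eventually_nhds_iff.1 hαΩ
  refine ⟨min e e', lt_min he he', fun t => if t < T then z t else α t, ?_, ?_⟩
  · intro t ht; simp [ht]
  intro t ht
  have ht1 : ¬ t < T := not_lt.2 ht.1
  have hte : t < T + e := lt_of_lt_of_le ht.2 (by gcongr; exact min_le_left _ _)
  have hte' : t < T + e' := lt_of_lt_of_le ht.2 (by gcongr; exact min_le_right _ _)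
  simp only [ht1, if_false]
  refine ⟨hα' (by rw [Real.dist_eq, abs_of_nonneg] <;> linarith [ht.1]), ?_⟩
  rcases eq_or_lt_of_le ht.1 with h | h
  · subst h
    rw [hα0]
    set w : ℝ → E := fun t => if t < T then z t else α t with hw
    have hwT : w T = y := by simp [hw, hα0]
    have hright : HasDerivWithinAt w (X y) (Ici T) T := by
      have := (hα T ⟨by linarith, by linarith⟩).hasDerivWithinAt (s := Ici T)
      rw [hα0] at this
      refine this.congr ?_ ?_
      · intro s hs; simp [hw, not_lt.2 (mem_Ici.1 hs)]
      · simp [hw]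
    have hd : ∀ s ∈ Ioo t₀ T, HasDerivAt w (X (z s)) s := by
      intro s hs
      refine (hz s ⟨hs.1.le, hs.2⟩).congr_of_eventuallyEq ?_
      filter_upwards [Iio_mem_nhds hs.2] with u hu
      simp [hw, mem_Iio.1 hu]
    have hleft : HasDerivWithinAt w (X y) (Iic T) T := by
      refine hasDerivWithinAt_Iic_of_tendsto_deriv (s := Ioo t₀ T)
        (fun s hs => (hd s hs).differentiableAt.differentiableWithinAt) ?_ hmem ?_
      · have : Tendsto w (𝓝[<] T) (𝓝 (w T)) := by
          rw [hwT]
          refine hzy.congr' ?_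
          filter_upwards [self_mem_nhdsWithin] with u hu
          simp [hw, mem_Iio.1 hu]
        exact this.mono_left (nhdsWithin_mono _ Ioo_subset_Iio_self)
      · have : Tendsto (fun s => X (z s)) (𝓝[<] T) (𝓝 (X y)) :=
          ((hX y hyΩ).continuousAt.tendsto).comp hzy
        refine this.congr' ?_
        filter_upwards [hmem] with s hs
        exact (hd s hs).deriv.symm
    simpa using hleft.union hright
  · refine (hα t ⟨by linarith, hte⟩).congr_of_eventuallyEq ?_
    filter_upwards [Ioi_mem_nhds h] with u hu
    simp [not_lt.2 (mem_Ioi.1 hu).le]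

/-- Pigeonhole: among `N + 1` geometric rings one contains no value. -/
lemma exists_empty_ring {N : ℕ} (f : Fin N → ℝ) (R Λ : ℝ) (hR : 0 < R) (hΛ : 1 ≤ Λ) :
    ∃ k ≤ N, ∀ a, f a ≤ R * Λ ^ k ∨ R * Λ ^ (k + 1) < f a := by
  by_contra! hc
  have : Nonempty (Fin N) := (hc 0 (Nat.zero_le _)).nonempty
  choose! g hg using hc
  have key : ∀ k l : ℕ, k ≤ N → l ≤ N → k < l → g k ≠ g l := by
    intro k l hk hl hkl heq
    have h1 := (hg k hk).2
    have h2 := (hg l hl).1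
    rw [heq] at h1
    have : R * Λ ^ (k + 1) ≤ R * Λ ^ l := by gcongr; exact hkl
    linarith
  have hinj : Function.Injective (fun k : Fin (N + 1) => g k) := by
    intro k l hkl
    by_contra hne
    rcases lt_or_gt_of_ne (fun h => hne (Fin.ext h) : (k : ℕ) ≠ l) with h | h
    · exact key k l (by omega) (by omega) h hkl
    · exact key l k (by omega) (by omega) h hkl.symm
  have := Fintype.card_le_of_injective _ hinj
  simp at this

lemma exists_close_pair {N : ℕ} (G : ℝ) (hG : 0 < G) (m : Fin N → ℝ) (hm : ∀ a, 0 < m a)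
    (h : ℝ) (R : ℝ) (hR : 0 < R) (hRh : G * (∑ a, m a) ^ 2 / R < h) (q : Config N)
    (hU : h ≤ potU G m q) : ∃ a b, a ≠ b ∧ ‖q a - q b‖ ≤ R := by
  by_contra! hc
  have : potU G m q ≤ G * (∑ a, m a) ^ 2 / R := by
    unfold potU
    rw [mul_div_assoc, sq, Finset.sum_mul_sum, Finset.sum_div]
    refine mul_le_mul_of_nonneg_left (Finset.sum_le_sum fun a _ => ?_) hG.le
    rw [Finset.sum_div]
    refine Finset.sum_le_sum fun b _ => ?_
    have hab := mul_pos (hm a) (hm b)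
    split_ifs with hlt
    · have := hc a b hlt.ne
      gcongr
    · positivity
  linarith

lemma pair_dist_lower {N : ℕ} (G : ℝ) (hG : 0 < G) (m : Fin N → ℝ) (hm : ∀ a, 0 < m a)
    (μ : ℝ) (hμ : 0 < μ) (hμm : ∀ a, μ ≤ m a) (B : ℝ) (hB : 0 < B) (q : Config N)
    (hcf : CollisionFree q) (hU : potU G m q ≤ B) (a b : Fin N) (hab : a ≠ b) :
    G * μ ^ 2 / B ≤ ‖q a - q b‖ := by
  wlog hlt : a < b generalizing a b
  · rw [norm_sub_rev]
    exact this b a hab.symm (lt_of_le_of_ne (not_lt.1 hlt) hab.symm)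
  have hpos : 0 < ‖q a - q b‖ := norm_pos_iff.2 (sub_ne_zero.2 (hcf a b hab))
  have hnn : ∀ c d : Fin N, 0 ≤ (if c < d then m c * m d / ‖q c - q d‖ else 0) := by
    intro c d
    have := mul_pos (hm c) (hm d)
    split_ifs <;> positivity
  have h1 : m a * m b / ‖q a - q b‖ ≤
      ∑ c : Fin N, ∑ d : Fin N, if c < d then m c * m d / ‖q c - q d‖ else 0 := by
    have e1 := Finset.single_le_sum (f := fun c => ∑ d : Fin N,
      if c < d then m c * m d / ‖q c - q d‖ else 0)
      (fun c _ => Finset.sum_nonneg fun d _ => hnn c d) (Finset.mem_univ a)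
    have e2 := Finset.single_le_sum (f := fun d =>
      if a < d then m a * m d / ‖q a - q d‖ else 0) (fun d _ => hnn a d) (Finset.mem_univ b)
    simp only [hlt, if_true] at e2
    exact e2.trans e1
  have h2 : μ ^ 2 ≤ m a * m b := by
    rw [sq]; exact mul_le_mul (hμm a) (hμm b) hμ.le (hm a).le
  have h3 : G * (m a * m b / ‖q a - q b‖) ≤ B :=
    (mul_le_mul_of_nonneg_left h1 hG.le).trans hU
  have h4 : G * (m a * m b) ≤ B * ‖q a - q b‖ := by
    rw [← mul_div_assoc, div_le_iff₀ hpos] at h3; exact h3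
  rw [div_le_iff₀ hB]
  nlinarith

lemma virial_bound {N : ℕ} (G : ℝ) (hG : 0 < G) (m : Fin N → ℝ) (hm : ∀ a, 0 < m a)
    (μ : ℝ) (hμ : 0 < μ) (hμm : ∀ a, μ ≤ m a) (q : Config N) (hcf : CollisionFree q)
    (S : Finset (Fin N)) (p : EuclideanSpace ℝ (Fin 3)) (a₀ b₀ : Fin N) (hne : a₀ ≠ b₀)
    (ha₀ : a₀ ∈ S) (hb₀ : b₀ ∈ S) (d R D : ℝ) (hd : ‖q a₀ - q b₀‖ ≤ d)
    (hR : 0 ≤ R) (hin : ∀ a ∈ S, ‖q a - p‖ ≤ R) (hD : 0 < D)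
    (hout : ∀ a ∈ S, ∀ b, b ∉ S → D ≤ ‖q b - q a‖) :
    ∑ a ∈ S, ⟪∑ b ∈ univ.filter (fun b => b ≠ a),
        (G * m a * m b / ‖q b - q a‖ ^ 3) • (q b - q a), q a - p⟫
      ≤ -(G * μ ^ 2 / d) + G * (∑ a, m a) ^ 2 * R / D ^ 2 := by
  set g : Fin N → Fin N → ℝ := fun a b =>
    G * m a * m b / ‖q b - q a‖ ^ 3 * ⟪q b - q a, q a - p⟫ with hg
  have e1 : ∀ a, ⟪∑ b ∈ univ.filter (fun b => b ≠ a),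
        (G * m a * m b / ‖q b - q a‖ ^ 3) • (q b - q a), q a - p⟫
      = ∑ b ∈ S, g a b + ∑ b ∈ Sᶜ, g a b := by
    intro a
    rw [Finset.sum_add_sum_compl, sum_inner]
    rw [Finset.sum_filter_of_ne]
    · simp only [hg, real_inner_smul_left]
    · intro b _ hb hba
      subst hba
      simp at hb
  rw [Finset.sum_congr rfl fun a _ => e1 a, Finset.sum_add_distrib]
  refine add_le_add ?_ ?_
  · set f : Fin N → Fin N → ℝ := fun a b => G * m a * m b / ‖q b - q a‖ with hf
    have hfn : ∀ a b, 0 ≤ f a b := fun a b => by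
      have := hm a; have := hm b; simp only [hf]; positivity
    have hgg : ∀ a b, g a b + g b a = - f a b := by
      intro a b
      simp only [hg, hf]
      rw [norm_sub_rev (q a) (q b)]
      by_cases hab : a = b
      · subst hab; simp
      have hpos : 0 < ‖q b - q a‖ := norm_pos_iff.2 (sub_ne_zero.2 (hcf b a (Ne.symm hab)))
      have hi : ⟪q b - q a, q a - p⟫ + ⟪q a - q b, q b - p⟫ = - ‖q b - q a‖ ^ 2 := by
        rw [← real_inner_self_eq_norm_sq]
        simp only [inner_sub_left, inner_sub_right, real_inner_comm]
        ring
      have : G * m a * m b / ‖q b - q a‖ ^ 3 * ⟪q b - q a, q a - p⟫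
        + G * m b * m a / ‖q b - q a‖ ^ 3 * ⟪q a - q b, q b - p⟫
        = G * m a * m b / ‖q b - q a‖ ^ 3 *
          (⟪q b - q a, q a - p⟫ + ⟪q a - q b, q b - p⟫) := by ring
      rw [this, hi]
      field_simp
    have hsym : 2 * ∑ a ∈ S, ∑ b ∈ S, g a b = - ∑ a ∈ S, ∑ b ∈ S, f a b := by
      rw [two_mul]
      nth_rewrite 2 [Finset.sum_comm]
      simp only [← Finset.sum_add_distrib, hgg, Finset.sum_neg_distrib]
    have hrow : ∀ a ∈ S, ∀ b ∈ S, f a b ≤ ∑ c ∈ S, f a c := fun a _ b hb =>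
      Finset.single_le_sum (f := fun c => f a c) (fun c _ => hfn a c) hb
    have hlow : f a₀ b₀ + f b₀ a₀ ≤ ∑ a ∈ S, ∑ b ∈ S, f a b := by
      have hsub : ({a₀, b₀} : Finset (Fin N)) ⊆ S := by
        intro x hx; simp only [Finset.mem_insert, Finset.mem_singleton] at hx
        rcases hx with rfl | rfl <;> assumption
      have := Finset.sum_le_sum_of_subset_of_nonneg (f := fun a => ∑ b ∈ S, f a b) hsub
        (fun a _ _ => Finset.sum_nonneg fun b _ => hfn a b)
      rw [Finset.sum_pair hne] at this
      linarith [hrow a₀ ha₀ b₀ hb₀, hrow b₀ hb₀ a₀ ha₀]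
    have hone : ∀ a b, a ≠ b → ‖q b - q a‖ ≤ d → G * μ ^ 2 / d ≤ f a b := by
      intro a b hab hd
      have hpos : 0 < ‖q b - q a‖ := norm_pos_iff.2 (sub_ne_zero.2 (hcf b a hab.symm))
      have h2 : μ ^ 2 ≤ m a * m b := by
        rw [sq]; exact mul_le_mul (hμm a) (hμm b) hμ.le (hm a).le
      simp only [hf, mul_assoc]
      have := mul_pos (hm a) (hm b)
      gcongr
    have := hone a₀ b₀ hne (by rwa [norm_sub_rev])
    have := hone b₀ a₀ hne.symm hd
    linarith
  · have hb : ∀ a ∈ S, ∀ b ∈ Sᶜ, g a b ≤ m a * m b * (G * R / D ^ 2) := by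
      intro a ha b hb
      have hDr := hout a ha b (Finset.mem_compl.1 hb)
      have hpos : 0 < ‖q b - q a‖ := hD.trans_le hDr
      have hma := hm a
      have hmb := hm b
      calc g a b ≤ G * m a * m b / ‖q b - q a‖ ^ 3 * (‖q b - q a‖ * R) := by
            simp only [hg]
            refine mul_le_mul_of_nonneg_left ?_ (by positivity)
            exact (real_inner_le_norm _ _).trans
              (mul_le_mul_of_nonneg_left (hin a ha) hpos.le)
        _ = m a * m b * (G * R / ‖q b - q a‖ ^ 2) := by field_simp
        _ ≤ _ := by gcongr
    calc ∑ a ∈ S, ∑ b ∈ Sᶜ, g a b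
        ≤ ∑ a ∈ S, ∑ b ∈ Sᶜ, m a * m b * (G * R / D ^ 2) :=
          Finset.sum_le_sum fun a ha => Finset.sum_le_sum fun b hb' => hb a ha b hb'
      _ = (∑ a ∈ S, m a) * (∑ b ∈ Sᶜ, m b) * (G * R / D ^ 2) := by
          rw [Finset.sum_mul_sum, Finset.sum_mul]
          simp only [Finset.sum_mul]
      _ ≤ (∑ a, m a) * (∑ b, m b) * (G * R / D ^ 2) := by
          have hs : ∀ T : Finset (Fin N), ∑ a ∈ T, m a ≤ ∑ a, m a := fun T =>
            Finset.sum_le_univ_sum_of_nonneg fun a => (hm a).le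
          have hn : ∀ T : Finset (Fin N), 0 ≤ ∑ a ∈ T, m a := fun T =>
            Finset.sum_nonneg fun a _ => (hm a).le
          refine mul_le_mul_of_nonneg_right ?_ (by positivity)
          exact mul_le_mul (hs _) (hs _) (hn _) (hn _)
      _ = _ := by ring

/-- Newtonian acceleration. -/
def accField {N : ℕ} (G : ℝ) (m : Fin N → ℝ) (q : Config N) : Config N := fun a =>
  ∑ b ∈ univ.filter (fun b => b ≠ a), (G * m b / ‖q b - q a‖ ^ 3) • (q b - q a)

lemma smul_accField {N : ℕ} (G : ℝ) (m : Fin N → ℝ) (q : Config N) (a : Fin N) :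
    m a • accField G m q a = ∑ b ∈ univ.filter (fun b => b ≠ a),
        (G * m a * m b / ‖q b - q a‖ ^ 3) • (q b - q a) := by
  unfold accField
  rw [Finset.smul_sum]
  refine Finset.sum_congr rfl fun b _ => ?_
  rw [smul_smul]
  congr 1
  ring

lemma hasDerivAt_vel {N : ℕ} {G : ℝ} {m : Fin N → ℝ} (hm : ∀ a, 0 < m a) {J : Set ℝ}
    {q v : ℝ → Config N} (hs : IsSolutionOn G m J q v) {t : ℝ} (ht : t ∈ J) (a : Fin N) :
    HasDerivAt (fun s => v s a) (accField G m (q t) a) t := by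
  obtain ⟨acc, h1, h2⟩ := (hs t ht).2.2 a
  rw [← smul_accField] at h2
  have := smul_right_injective _ (hm a).ne' h2
  rwa [← this]

lemma isOpen_collisionFree (N : ℕ) : IsOpen {q : Config N | CollisionFree q} := by
  have : {q : Config N | CollisionFree q} =
      ⋂ a : Fin N, ⋂ b : Fin N, {q : Config N | a ≠ b → q a ≠ q b} := by
    ext q; simp [CollisionFree]
  rw [this]
  refine isOpen_iInter_of_finite fun a => isOpen_iInter_of_finite fun b => ?_
  by_cases hab : a = b
  · simp [hab]
  · simp only [ne_eq, hab, not_false_eq_true, forall_const]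
    exact isOpen_ne_fun (continuous_apply a) (continuous_apply b)

lemma contDiffAt_accField {N : ℕ} (G : ℝ) (m : Fin N → ℝ) (q : Config N)
    (hq : CollisionFree q) : ContDiffAt ℝ 1 (accField G m) q := by
  rw [contDiffAt_pi]
  intro a
  unfold accField
  refine ContDiffAt.sum fun b hb => ?_
  have hba : b ≠ a := (Finset.mem_filter.1 hb).2
  have hsub : ContDiffAt ℝ 1 (fun q : Config N => q b - q a) q :=
    ((contDiff_apply ℝ _ b).sub (contDiff_apply ℝ _ a)).contDiffAt
  have hne : q b - q a ≠ 0 := sub_ne_zero.2 (hq b a hba)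
  have hn := hsub.norm ℝ hne
  exact ((contDiffAt_const (c := G * m b)).div (hn.pow 3)
    (pow_ne_zero 3 (norm_ne_zero_iff.2 hne))).smul hsub

set_option maxHeartbeats 1000000 in
open Set Topology in
lemma no_bounded_end {N : ℕ} {G : ℝ} (hG : 0 < G) {m : Fin N → ℝ} (hm : ∀ a, 0 < m a)
    {J : Set ℝ} {q v : ℝ → Config N} (hs : IsMaximalSolution G m J q v)
    (t₀ T : ℝ) (hT : t₀ < T) (hTJ : T ∉ J) (hJ : Ico t₀ T ⊆ J) (V d : ℝ) (hd : 0 < d)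
    (hV : ∀ t ∈ Ico t₀ T, ∀ a, ‖v t a‖ ≤ V)
    (hdist : ∀ t ∈ Ico t₀ T, ∀ a b, a ≠ b → d ≤ ‖q t a - q t b‖) : False := by
  obtain ⟨hJo, hJc, hsol, hmax⟩ := hs
  set X : Config N × Config N → Config N × Config N := fun x => (x.2, accField G m x.1) with hX
  set Ω : Set (Config N × Config N) := Prod.fst ⁻¹' {q : Config N | CollisionFree q} with hΩ
  have hΩo : IsOpen Ω := (isOpen_collisionFree N).preimage continuous_fst
  have hXc : ∀ x ∈ Ω, ContDiffAt ℝ 1 X x := by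
    intro x hx
    exact contDiffAt_snd.prodMk ((contDiffAt_accField G m x.1 hx).comp x contDiffAt_fst)
  set z : ℝ → Config N × Config N := fun t => (q t, v t) with hz
  have hzd : ∀ t ∈ J, HasDerivAt z (X (z t)) t := by
    intro t ht
    refine HasDerivAt.prodMk ?_ ?_
    · exact hasDerivAt_pi.2 fun a => (hsol t ht).2.1 a
    · exact hasDerivAt_pi.2 fun a => hasDerivAt_vel hm hsol ht a
  have hMn : 0 ≤ ∑ b, G * m b := Finset.sum_nonneg fun b _ => (mul_pos hG (hm b)).le
  set A : ℝ := (∑ b, G * m b) / d ^ 2 with hA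
  have hA0 : 0 ≤ A := by positivity
  have hacc : ∀ t ∈ Ico t₀ T, ∀ a, ‖accField G m (q t) a‖ ≤ A := by
    intro t ht a
    unfold accField
    refine (norm_sum_le _ _).trans ?_
    rw [hA, Finset.sum_div]
    refine (Finset.sum_le_sum (g := fun b => G * m b / d ^ 2) ?_).trans
      (Finset.sum_le_univ_sum_of_nonneg fun b => by have := hm b; positivity)
    intro b hb
    have hba : b ≠ a := (Finset.mem_filter.1 hb).2
    have hr := hdist t ht b a hba
    have hr0 : 0 < ‖q t b - q t a‖ := hd.trans_le hr
    have hmb := hm b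
    rw [norm_smul, Real.norm_of_nonneg (by positivity)]
    calc G * m b / ‖q t b - q t a‖ ^ 3 * ‖q t b - q t a‖ = G * m b / ‖q t b - q t a‖ ^ 2 := by
          field_simp
      _ ≤ _ := by gcongr
  set L : ℝ := max 0 (max V A) with hL
  have hL0 : 0 ≤ L := le_max_left _ _
  have hlip : LipschitzOnWith L.toNNReal z (Ico t₀ T) := by
    refine Convex.lipschitzOnWith_of_nnnorm_hasDerivWithin_le (f' := fun t => X (z t))
      (convex_Ico t₀ T) (fun t ht => (hzd t (hJ ht)).hasDerivWithinAt) ?_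
    intro t ht
    rw [← NNReal.coe_le_coe, coe_nnnorm, Real.coe_toNNReal _ hL0]
    refine max_le ?_ ?_
    · refine (pi_norm_le_iff_of_nonneg hL0).2 fun a => ?_
      exact (hV t ht a).trans ((le_max_left _ _).trans (le_max_right _ _))
    · refine (pi_norm_le_iff_of_nonneg hL0).2 fun a => ?_
      exact (hacc t ht a).trans ((le_max_right _ _).trans (le_max_right _ _))
  obtain ⟨δ, hδ, w, hw1, hw2⟩ := ode_extend X Ω hΩo hXc z t₀ T hT L.toNNReal
    (fun t ht => hzd t (hJ ht)) hlip (by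
      intro y hy a b hab
      have h1 : Tendsto (fun t => ‖q t a - q t b‖) (𝓝[<] T) (𝓝 ‖y.1 a - y.1 b‖) := by
        have hq : Tendsto q (𝓝[<] T) (𝓝 y.1) := hy.fst_nhds
        exact ((tendsto_pi_nhds.1 hq a).sub (tendsto_pi_nhds.1 hq b)).norm
      have h2 : d ≤ ‖y.1 a - y.1 b‖ := by
        refine ge_of_tendsto h1 ?_
        filter_upwards [Ioo_mem_nhdsLT hT] with t ht
        exact hdist t ⟨ht.1.le, ht.2⟩ a b hab
      intro he
      rw [he, sub_self, norm_zero] at h2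
      linarith)
  have ht₀J : t₀ ∈ J := hJ ⟨le_rfl, hT⟩
  have hJlt : ∀ t ∈ J, t < T := by
    intro t ht
    by_contra hge
    exact hTJ (hJc.out ht₀J ht ⟨hT.le, not_lt.1 hge⟩)
  have hunion : J ∪ Ico T (T + δ) = J ∪ Ioo t₀ (T + δ) := by
    ext t
    simp only [Set.mem_union, Set.mem_Ico, Set.mem_Ioo]
    constructor
    · rintro (h | h)
      · exact Or.inl h
      · exact Or.inr ⟨by linarith, h.2⟩
    · rintro (h | h)
      · exact Or.inl h
      · by_cases hlt : t < T
        · exact Or.inl (hJ ⟨h.1.le, hlt⟩)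
        · exact Or.inr ⟨not_lt.1 hlt, h.2⟩
  have hEq := hmax (J ∪ Ico T (T + δ)) (fun t => (w t).1) (fun t => (w t).2)
    (by rw [hunion]; exact hJo.union isOpen_Ioo)
    (by
      refine ⟨fun x hx y hy s hs => ?_⟩
      by_cases hsT : s < T
      · by_cases hst : t₀ ≤ s
        · exact Or.inl (hJ ⟨hst, hsT⟩)
        · rcases hx with hx | hx
          · exact Or.inl (hJc.out hx ht₀J ⟨hs.1, (not_le.1 hst).le⟩)
          · exact absurd (hx.1.trans hs.1) (not_le.2 hsT)
      · refine Or.inr ⟨not_lt.1 hsT, ?_⟩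
        rcases hy with hy | hy
        · have := hJlt y hy
          linarith [hs.2]
        · exact lt_of_le_of_lt hs.2 hy.2)
    (by
      have hwd : ∀ t ∈ J ∪ Ico T (T + δ), w t ∈ Ω ∧ HasDerivAt w (X (w t)) t := by
        rintro t (ht | ht)
        · have hlt := hJlt t ht
          rw [hw1 t hlt]
          refine ⟨(hsol t ht).1, (hzd t ht).congr_of_eventuallyEq ?_⟩
          filter_upwards [Iio_mem_nhds hlt] with u hu
          exact hw1 u hu
        · exact hw2 t ht
      intro t ht
      obtain ⟨h1, h2⟩ := hwd t ht
      refine ⟨h1, fun a => ?_, fun a => ⟨accField G m (w t).1 a, ?_, smul_accField _ _ _ _⟩⟩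
      · have h3 : HasDerivAt (fun s => (w s).1) (w t).2 t := 
          (hasFDerivAt_fst (𝕜 := ℝ) (p := w t)).comp_hasDerivAt t h2
        exact hasDerivAt_pi.1 h3 a
      · have h3 : HasDerivAt (fun s => (w s).2) (accField G m (w t).1) t :=
          (hasFDerivAt_snd (𝕜 := ℝ) (p := w t)).comp_hasDerivAt t h2
        exact hasDerivAt_pi.1 h3 a)
    Set.subset_union_left
    (by
      intro t ht
      rw [hw1 t (hJlt t ht)]
      exact ⟨rfl, rfl⟩)
  exact hTJ (hEq ▸ Or.inr ⟨le_rfl, by linarith⟩)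

open Set in
/-- The virial estimate along a slow arc of solution: the arc cannot be long. -/
lemma slow_arc_short {N : ℕ} {G : ℝ} (hG : 0 < G) {m : Fin N → ℝ} (hm : ∀ a, 0 < m a)
    {μ : ℝ} (hμ : 0 < μ) (hμm : ∀ a, μ ≤ m a) {J : Set ℝ} {q v : ℝ → Config N}
    (hs : IsSolutionOn G m J q v) {t₀ t₁ : ℝ} (ht : t₀ ≤ t₁) (hJ : Icc t₀ t₁ ⊆ J)
    {h R₀ Λ W e M : ℝ} (hM : M = ∑ a, m a) (hM0 : 0 < M) (hR₀ : 0 < R₀)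
    (hRh : G * M ^ 2 / R₀ < h) (hΛ : Λ = 3 + 5 * M / μ) (hU : h ≤ potU G m (q t₀))
    (hW : 0 ≤ W) (hv : ∀ t ∈ Icc t₀ t₁, ∀ a, ‖v t a‖ ≤ W)
    (hkin : ∀ t ∈ Icc t₀ t₁, ∑ a, m a * ‖v t a‖ ^ 2 ≤ e)
    (he : e ≤ G * μ ^ 2 / (12 * R₀)) (hdisp : W * (t₁ - t₀) ≤ R₀) :
    G * μ ^ 2 / (6 * R₀) * (t₁ - t₀) ≤ 2 * (M * W * (2 * (R₀ * Λ ^ N))) := by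
  have hΛ3 : 3 < Λ := by rw [hΛ]; have : 0 < 5 * M / μ := by positivity
                         linarith
  have ht₀ : t₀ ∈ Icc t₀ t₁ := ⟨le_rfl, ht⟩
  have ht₁ : t₁ ∈ Icc t₀ t₁ := ⟨ht, le_rfl⟩
  obtain ⟨a₀, b₀, hne, hab⟩ := exists_close_pair G hG m hm h R₀ hR₀ (hM ▸ hRh) (q t₀) hU
  set p := q t₀ a₀ with hp
  obtain ⟨k, hk, hring⟩ := exists_empty_ring (fun a => ‖q t₀ a - p‖) R₀ Λ hR₀ (by linarith)
  set R := R₀ * Λ ^ k with hR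
  have hRR : R₀ ≤ R := le_mul_of_one_le_right hR₀.le (one_le_pow₀ (by linarith))
  have hRmax : R ≤ R₀ * Λ ^ N := by
    rw [hR]; gcongr; linarith
  have hR0 : 0 < R := hR₀.trans_le hRR
  set S : Finset (Fin N) := univ.filter (fun a => ‖q t₀ a - p‖ ≤ R) with hS
  have hmemS : ∀ a, a ∈ S ↔ ‖q t₀ a - p‖ ≤ R := fun a => by simp [hS]
  have hnotS : ∀ a, a ∉ S → Λ * R ≤ ‖q t₀ a - p‖ := by
    intro a ha
    rw [hmemS] at ha
    rcases hring a with h1 | h1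
    · exact absurd h1 ha
    · rw [pow_succ] at h1
      have : Λ * R = R₀ * (Λ ^ k * Λ) := by rw [hR]; ring
      rw [this]; exact h1.le
  have ha₀ : a₀ ∈ S := by rw [hmemS, hp, sub_self, norm_zero]; exact hR0.le
  have hb₀ : b₀ ∈ S := by rw [hmemS, hp, norm_sub_rev]; exact hab.trans hRR
  have hmove : ∀ t ∈ Icc t₀ t₁, ∀ a, ‖q t a - q t₀ a‖ ≤ R₀ := by
    intro t htt a
    have := Convex.norm_image_sub_le_of_norm_hasDerivWithin_le (f := fun s => q s a)
      (f' := fun s => v s a) (C := W) (fun x hx => ((hs x (hJ hx)).2.1 a).hasDerivWithinAt)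
      (fun x hx => hv x hx a) (convex_Icc t₀ t₁) ht₀ htt
    refine this.trans (le_trans ?_ hdisp)
    rw [Real.norm_of_nonneg (by linarith [htt.1])]
    exact mul_le_mul_of_nonneg_left (by linarith [htt.2]) hW
  have hin : ∀ t ∈ Icc t₀ t₁, ∀ a ∈ S, ‖q t a - p‖ ≤ 2 * R := by
    intro t htt a ha
    have h1 := hmove t htt a
    have h2 := (hmemS a).1 ha
    have h3 := norm_sub_le_norm_sub_add_norm_sub (q t a) (q t₀ a) p
    linarith
  have hout : ∀ t ∈ Icc t₀ t₁, ∀ a ∈ S, ∀ b, b ∉ S → (Λ - 3) * R ≤ ‖q t b - q t a‖ := by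
    intro t htt a ha b hb
    have h1 := hmove t htt a
    have h1' := hmove t htt b
    have h2 := (hmemS a).1 ha
    have h3 := hnotS b hb
    have h4 := norm_sub_le_norm_sub_add_norm_sub (q t₀ b) (q t b) p
    have h5 := norm_sub_le_norm_sub_add_norm_sub (q t b) (q t a) p
    have h6 := norm_sub_le_norm_sub_add_norm_sub (q t a) (q t₀ a) p
    rw [norm_sub_rev (q t₀ b) (q t b)] at h4
    linarith
  have hclose : ∀ t ∈ Icc t₀ t₁, ‖q t a₀ - q t b₀‖ ≤ 3 * R₀ := by
    intro t htt
    have h1 := hmove t htt a₀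
    have h2 := hmove t htt b₀
    have h4 := norm_sub_le_norm_sub_add_norm_sub (q t a₀) (q t₀ a₀) (q t b₀)
    have h5 := norm_sub_le_norm_sub_add_norm_sub (q t₀ a₀) (q t₀ b₀) (q t b₀)
    rw [norm_sub_rev (q t₀ b₀)] at h5
    linarith
  set F : ℝ → ℝ := fun t => ∑ a ∈ S, m a * ⟪v t a, q t a - p⟫ with hF
  have hFd : ∀ t ∈ Icc t₀ t₁, HasDerivAt F (∑ a ∈ S, m a *
      (⟪v t a, v t a⟫ + ⟪accField G m (q t) a, q t a - p⟫)) t := by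
    intro t htt
    refine HasDerivAt.fun_sum fun a _ => ?_
    exact ((hasDerivAt_vel hm hs (hJ htt) a).inner ℝ
      (((hs t (hJ htt)).2.1 a).sub_const p)).const_mul (m a)
  have hFle : ∀ t ∈ Icc t₀ t₁, ∑ a ∈ S, m a *
      (⟪v t a, v t a⟫ + ⟪accField G m (q t) a, q t a - p⟫) ≤ -(G * μ ^ 2 / (6 * R₀)) := by
    intro t htt
    have hvir := virial_bound G hG m hm μ hμ hμm (q t) (hs t (hJ htt)).1 S p a₀ b₀ hne ha₀ hb₀
      (3 * R₀) (2 * R) ((Λ - 3) * R) (hclose t htt) (by positivity) (hin t htt)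
      (mul_pos (by linarith) hR0) (hout t htt)
    rw [← hM] at hvir
    simp only [← smul_accField, real_inner_smul_left] at hvir
    simp only [mul_add, Finset.sum_add_distrib]
    have hk1 : ∑ a ∈ S, m a * ⟪v t a, v t a⟫ ≤ e := by
      refine le_trans ?_ (hkin t htt)
      simp only [real_inner_self_eq_norm_sq]
      exact Finset.sum_le_univ_sum_of_nonneg fun a => by have := hm a; positivity
    have hext : G * M ^ 2 * (2 * R) / ((Λ - 3) * R) ^ 2 ≤ 2 / 25 * (G * μ ^ 2 / R₀) := by
      have : G * M ^ 2 * (2 * R) / ((Λ - 3) * R) ^ 2 = 2 / 25 * (G * μ ^ 2 / R) := by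
        rw [hΛ]; field_simp; ring
      rw [this]; gcongr
    have e1 : G * μ ^ 2 / (3 * R₀) = 1 / 3 * (G * μ ^ 2 / R₀) := by field_simp
    have e2 : G * μ ^ 2 / (12 * R₀) = 1 / 12 * (G * μ ^ 2 / R₀) := by field_simp
    have e3 : G * μ ^ 2 / (6 * R₀) = 1 / 6 * (G * μ ^ 2 / R₀) := by field_simp
    have hpos : 0 < G * μ ^ 2 / R₀ := by positivity
    rw [e1] at hvir
    rw [e2] at he
    rw [e3]
    linarith
  have hmv := Convex.image_sub_le_mul_sub_of_deriv_le (convex_Icc t₀ t₁) (f := F)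
    (C := -(G * μ ^ 2 / (6 * R₀)))
    (fun t htt => (hFd t htt).continuousAt.continuousWithinAt)
    (fun t htt => (hFd t (interior_subset htt)).differentiableAt.differentiableWithinAt)
    (fun t htt => by rw [(hFd t (interior_subset htt)).deriv]; exact hFle t (interior_subset htt))
    t₀ ht₀ t₁ ht₁ ht
  have hFb : ∀ t ∈ Icc t₀ t₁, |F t| ≤ M * W * (2 * (R₀ * Λ ^ N)) := by
    intro t htt
    calc |F t| ≤ ∑ a ∈ S, |m a * ⟪v t a, q t a - p⟫| := Finset.abs_sum_le_sum_abs _ _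
      _ ≤ ∑ a ∈ S, m a * (W * (2 * (R₀ * Λ ^ N))) := by
          refine Finset.sum_le_sum fun a ha => ?_
          rw [abs_mul, abs_of_pos (hm a)]
          refine mul_le_mul_of_nonneg_left ?_ (hm a).le
          refine (abs_real_inner_le_norm _ _).trans ?_
          refine mul_le_mul (hv t htt a) ((hin t htt a ha).trans (by linarith))
            (norm_nonneg _) hW
      _ ≤ ∑ a, m a * (W * (2 * (R₀ * Λ ^ N))) :=
          Finset.sum_le_univ_sum_of_nonneg fun a => by
            have := hm a
            have : 0 < Λ := by linarith
            positivity
      _ = _ := by rw [← Finset.sum_mul, ← hM]; ring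
  have h1 := (abs_le.1 (hFb t₀ ht₀)).2
  have h2 := (abs_le.1 (hFb t₁ ht₁)).1
  linarith

/-- quantitative exit from a neighborhood of the Hill boundary:
for fixed `h > 0` there are `ε₀ > 0`, `K > 1`, `C > 0` such that for every
`ε ∈ (0, ε₀)`, any maximal energy `-h` solution with `U(q(t₀)) ≤ h + ε` reaches
`U ≥ h + Kε` at some time `t₁ ∈ (t₀, t₀ + C√ε]` within its domain. -/
theorem quantitative_exit_from_hill_boundary
    (N : ℕ) (hN : 2 ≤ N) (G : ℝ) (hG : 0 < G)
    (m : Fin N → ℝ) (hm : ∀ a, 0 < m a)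
    (h : ℝ) (hh : 0 < h) :
    ∃ ε₀ > (0:ℝ), ∃ K > (1:ℝ), ∃ C > (0:ℝ),
      ∀ ε : ℝ, 0 < ε → ε < ε₀ →
      ∀ (J : Set ℝ) (q v : ℝ → Config N) (t₀ : ℝ),
        IsMaximalSolution G m J q v →
        (∀ t ∈ J, kinE m (v t) - potU G m (q t) = -h) →
        t₀ ∈ J → potU G m (q t₀) ≤ h + ε →
        ∃ t₁ ∈ J, t₀ < t₁ ∧ t₁ ≤ t₀ + C * Real.sqrt ε ∧
          h + K * ε ≤ potU G m (q t₁) := by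
  have hne : Nonempty (Fin N) := ⟨⟨0, by omega⟩⟩
  obtain ⟨μ, hμ, hμm⟩ : ∃ μ > (0:ℝ), ∀ a, μ ≤ m a := by
    obtain ⟨a, ha⟩ := Finite.exists_min m
    exact ⟨m a, hm a, ha⟩
  obtain ⟨M, hM⟩ : ∃ M, M = ∑ a, m a := ⟨_, rfl⟩
  have hM0 : 0 < M := by rw [hM]; exact Finset.sum_pos (fun a _ => hm a) Finset.univ_nonempty
  obtain ⟨R₀, hR⟩ : ∃ R₀, R₀ = 2 * G * M ^ 2 / h := ⟨_, rfl⟩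
  have hR₀ : 0 < R₀ := by rw [hR]; positivity
  have hRh : G * M ^ 2 / R₀ < h := by
    rw [div_lt_iff₀ hR₀]
    have e : h * R₀ = 2 * (G * M ^ 2) := by rw [hR]; field_simp
    have : 0 < G * M ^ 2 := by positivity
    linarith
  obtain ⟨Λ, hΛ⟩ : ∃ Λ, Λ = 3 + 5 * M / μ := ⟨_, rfl⟩
  have hΛ0 : 0 < Λ := by rw [hΛ]; positivity
  obtain ⟨s, hs⟩ : ∃ s, s = 2 / Real.sqrt μ := ⟨_, rfl⟩
  have hsμ : 0 < Real.sqrt μ := Real.sqrt_pos.2 hμ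
  have hs0 : 0 < s := by rw [hs]; positivity
  have hs2 : μ * s ^ 2 = 4 := by
    rw [hs, div_pow, Real.sq_sqrt hμ.le]; field_simp; norm_num
  obtain ⟨B, hB⟩ : ∃ B, B = 2 * (M * s * (2 * (R₀ * Λ ^ N))) := ⟨_, rfl⟩
  have hB0 : 0 < B := by rw [hB]; positivity
  obtain ⟨κ, hκ⟩ : ∃ κ, κ = G * μ ^ 2 / (6 * R₀) := ⟨_, rfl⟩
  have hκ0 : 0 < κ := by rw [hκ]; positivity
  obtain ⟨C, hC⟩ : ∃ C, C = B / κ + 1 := ⟨_, rfl⟩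
  have hC0 : 0 < C := by rw [hC]; positivity
  refine ⟨min (G * μ ^ 2 / (48 * R₀)) (R₀ / (s * C)), by positivity, 2, by norm_num, C, hC0, ?_⟩
  intro ε hε hεlt J q v t₀ hmax hE ht₀ hU₀
  have hε1 : ε < G * μ ^ 2 / (48 * R₀) := hεlt.trans_le (min_le_left _ _)
  have hε2 : ε < R₀ / (s * C) := hεlt.trans_le (min_le_right _ _)
  have hsε : 0 < Real.sqrt ε := Real.sqrt_pos.2 hε
  have hsq : Real.sqrt ε ^ 2 = ε := Real.sq_sqrt hε.le
  obtain ⟨τ, hτ⟩ : ∃ τ, τ = t₀ + C * Real.sqrt ε := ⟨_, rfl⟩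
  have hτt : t₀ < τ := by rw [hτ]; linarith [mul_pos hC0 hsε]
  by_contra! hcon
  rw [← hτ] at hcon
  have hUlt : ∀ t ∈ J, t ∈ Set.Icc t₀ τ → potU G m (q t) < h + 2 * ε := by
    intro t htJ ht
    rcases eq_or_lt_of_le ht.1 with h1 | h1
    · rw [← h1]; linarith
    · exact hcon t htJ h1 ht.2
  have hkin : ∀ t ∈ J, t ∈ Set.Icc t₀ τ → ∑ a, m a * ‖v t a‖ ^ 2 ≤ 4 * ε := by
    intro t htJ ht
    have h1 := hUlt t htJ ht
    have h2 := hE t htJ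
    unfold kinE at h2
    linarith
  have hvel : ∀ t ∈ J, t ∈ Set.Icc t₀ τ → ∀ a, ‖v t a‖ ≤ s * Real.sqrt ε := by
    intro t htJ ht a
    have h1 := hkin t htJ ht
    have h2 := Finset.single_le_sum (f := fun a => m a * ‖v t a‖ ^ 2)
      (fun b _ => by have := hm b; positivity) (Finset.mem_univ a)
    have h3 : μ * ‖v t a‖ ^ 2 ≤ m a * ‖v t a‖ ^ 2 :=
      mul_le_mul_of_nonneg_right (hμm a) (by positivity)
    have h4 : μ * ‖v t a‖ ^ 2 ≤ μ * (s * Real.sqrt ε) ^ 2 := by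
      rw [mul_pow, hsq, ← mul_assoc, hs2]; linarith
    exact le_of_sq_le_sq (le_of_mul_le_mul_left h4 hμ) (by positivity)
  have hsol := hmax.2.2.1
  have hIcc : Set.Icc t₀ τ ⊆ J := by
    by_contra hnot
    obtain ⟨x, hx, hxJ⟩ := Set.not_subset.1 hnot
    have hcl : IsClosed (Set.Ici t₀ ∩ Jᶜ) := isClosed_Ici.inter hmax.1.isClosed_compl
    have hbd : BddBelow (Set.Ici t₀ ∩ Jᶜ) := ⟨t₀, fun y hy => hy.1⟩
    have hTm := hcl.csInf_mem ⟨x, hx.1, hxJ⟩ hbd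
    obtain ⟨T, hT⟩ : ∃ T, T = sInf (Set.Ici t₀ ∩ Jᶜ) := ⟨_, rfl⟩
    rw [← hT] at hTm
    have hTx : T ≤ x := by rw [hT]; exact csInf_le hbd ⟨hx.1, hxJ⟩
    have hTt : t₀ < T := lt_of_le_of_ne hTm.1 (fun hh => hTm.2 (hh ▸ ht₀))
    have hsub : Set.Ico t₀ T ⊆ J := by
      intro y hy
      by_contra hyJ
      have : T ≤ y := by rw [hT]; exact csInf_le hbd ⟨hy.1, hyJ⟩
      exact absurd hy.2 (not_lt.2 this)
    have hin : ∀ t ∈ Set.Ico t₀ T, t ∈ Set.Icc t₀ τ := fun t ht =>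
      ⟨ht.1, ht.2.le.trans (hTx.trans hx.2)⟩
    exact no_bounded_end hG hm hmax t₀ T hTt hTm.2 hsub (s * Real.sqrt ε)
      (G * μ ^ 2 / (h + 2 * ε)) (by positivity)
      (fun t ht a => hvel t (hsub ht) (hin t ht) a)
      (fun t ht a b hab => pair_dist_lower G hG m hm μ hμ hμm (h + 2 * ε) (by positivity) (q t)
        (hsol t (hsub ht)).1 (hUlt t (hsub ht) (hin t ht)).le a b hab)
  have hUh : h ≤ potU G m (q t₀) := by
    have h1 := hE t₀ ht₀
    have h2 : 0 ≤ kinE m (v t₀) := by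
      unfold kinE
      have : 0 ≤ ∑ a, m a * ‖v t₀ a‖ ^ 2 :=
        Finset.sum_nonneg fun a _ => by have := hm a; positivity
      linarith
    linarith
  have hfin := slow_arc_short hG hm hμ hμm hsol hτt.le hIcc (W := s * Real.sqrt ε) (e := 4 * ε)
    hM hM0 hR₀ hRh hΛ hUh (by positivity) (fun t ht a => hvel t (hIcc ht) ht a)
    (fun t ht => hkin t (hIcc ht) ht)
    (by
      have : G * μ ^ 2 / (12 * R₀) = 4 * (G * μ ^ 2 / (48 * R₀)) := by field_simp; norm_num
      rw [this]; linarith)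
    (by
      have : s * Real.sqrt ε * (τ - t₀) = ε * (s * C) := by
        rw [hτ]; linear_combination (s * C) * hsq
      rw [this]
      exact ((lt_div_iff₀ (by positivity)).1 hε2).le)
  rw [← hκ, hτ] at hfin
  have e1 : κ * (t₀ + C * Real.sqrt ε - t₀) = (B + κ) * Real.sqrt ε := by
    rw [hC]; field_simp; ring
  have e2 : 2 * (M * (s * Real.sqrt ε) * (2 * (R₀ * Λ ^ N))) = B * Real.sqrt ε := by
    rw [hB]; ring
  rw [e1, e2] at hfin
  linarith [mul_pos hκ0 hsε]
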